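/- arXiv:2303.14855 — 2 statements merged into one kernel-verified Lean document; each statement's English description precedes it below -/
import Mathlib

section
/- Let p,q ∈ (1,∞), let μ, λ be weights, set λ' := λ^{−q'/q} and ν^{1/p+1/q'} := μ^{1/p} λ^{−1/q}. Then, for the dyadic versions of the weight characteristics, [μ]_{A_∞(ν)} ≲ [μ,λ']_{B_{p,q'}(ν)}^p and [λ']_{A_∞(ν)} ≲ [μ,λ']_{B_{p,q'}(ν)}^{q'}, where [μ,λ']_{B_{p,q'}(ν)} := sup_Q (μ(Q)/ν(Q))^{1/p} (λ'(Q)/ν(Q))^{1/q'} with suprema over dyadic cubes. -/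
open MeasureTheory ENNReal Set Filter

noncomputable section

/-- `ℝ^d` with the Euclidean structure. -/
abbrev Rd (d : ℕ) := EuclideanSpace ℝ (Fin d)

variable {d : ℕ}

/-- An axis-parallel cube in `ℝ^d`, given by a corner and a (positive) side length. -/
structure Cube (d : ℕ) where
  corner : Fin d → ℝ
  side : ℝ
  side_pos : 0 < side

namespace Cube

/-- The set of points of the cube. -/
def carrier (Q : Cube d) : Set (Rd d) :=
  {x | ∀ i, Q.corner i ≤ x i ∧ x i < Q.corner i + Q.side}

/-- The volume `|Q| = ℓ(Q)^d` of the cube. -/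
def vol (Q : Cube d) : ℝ := Q.side ^ d

/-- The concentric cube with twice the side length. -/
def double (Q : Cube d) : Cube d :=
  ⟨fun i => Q.corner i - Q.side / 2, 2 * Q.side, by have := Q.side_pos; linarith⟩

end Cube

/-- `∫_Q f`. -/
def intC (Q : Cube d) (f : Rd d → ℝ) : ℝ := ∫ x in Q.carrier, f x

/-- `w(Q) = ∫_Q w`. -/
def wInt (Q : Cube d) (w : Rd d → ℝ) : ℝ := intC Q w

/-- The average `⟨f⟩_Q = |Q|⁻¹ ∫_Q f`. -/
def avg (Q : Cube d) (f : Rd d → ℝ) : ℝ := Q.vol⁻¹ * intC Q f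

/-- The mean oscillation `∫_Q |f - ⟨f⟩_Q|`. -/
def osc (Q : Cube d) (b : Rd d → ℝ) : ℝ := ∫ x in Q.carrier, |b x - avg Q b|

/-- The conjugate (dual) exponent `p' = p/(p-1)`. -/
def conj (p : ℝ) : ℝ := p / (p - 1)

/-- The weighted Lebesgue norm `‖f‖_{L^p(w)} = (∫ |f|^p w dx)^{1/p}`. -/
def wnorm (p : ℝ) (w : Rd d → ℝ) (f : Rd d → ℝ) : ℝ≥0∞ :=
  (∫⁻ x, ENNReal.ofReal (|f x| ^ p * w x)) ^ (1 / p)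

/-- The weighted Lebesgue norm of an `ℝ≥0∞`-valued function. -/
def wnormE (p : ℝ) (w : Rd d → ℝ) (f : Rd d → ℝ≥0∞) : ℝ≥0∞ :=
  (∫⁻ x, f x ^ p * ENNReal.ofReal (w x)) ^ (1 / p)

/-- A weight: a positive, measurable, locally integrable function. -/
def IsWeight (w : Rd d → ℝ) : Prop :=
  (∀ x, 0 < w x) ∧ Measurable w ∧ LocallyIntegrable w volume

/-- `b ∈ L¹_loc`. -/
def L1loc (b : Rd d → ℝ) : Prop := Measurable b ∧ LocallyIntegrable b volume

/-- Bounded measurable functions with compact support (the class `L^∞_c`). -/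
def BddCompactSupp (f : Rd d → ℝ) : Prop :=
  Measurable f ∧ HasCompactSupport f ∧ ∃ M : ℝ, ∀ x, |f x| ≤ M

/-- `‖U‖_{L^p(μ) → L^q(λ)} ≤ N`, tested on all measurable functions. -/
def OpBound (p q : ℝ) (μ lam : Rd d → ℝ) (U : (Rd d → ℝ) → Rd d → ℝ) (N : ℝ) : Prop :=
  ∀ f : Rd d → ℝ, Measurable f → wnorm q lam (U f) ≤ ENNReal.ofReal N * wnorm p μ f

/-- `‖U‖_{L^p(μ) → L^q(λ)} ≤ N`, tested on the dense class `L^∞_c`. -/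
def OpBoundCS (p q : ℝ) (μ lam : Rd d → ℝ) (U : (Rd d → ℝ) → Rd d → ℝ) (N : ℝ) : Prop :=
  ∀ f : Rd d → ℝ, BddCompactSupp f → wnorm q lam (U f) ≤ ENNReal.ofReal N * wnorm p μ f

/-- The weighted sharp maximal function, with cubes restricted to the family `𝒟`. -/
def sharpMaxOn (𝒟 : Set (Cube d)) (ν b : Rd d → ℝ) (x : Rd d) : ℝ≥0∞ :=
  ⨆ (Q : Cube d) (_ : Q ∈ 𝒟) (_ : x ∈ Q.carrier), ENNReal.ofReal (osc Q b / wInt Q ν)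

/-- `‖M^♯_ν b‖_{L^r(ν)}`. -/
def sharpNormOn (𝒟 : Set (Cube d)) (r : ℝ) (ν b : Rd d → ℝ) : ℝ≥0∞ :=
  wnormE r ν (sharpMaxOn 𝒟 ν b)

/-- `‖b‖_{BMO_ν^α} = sup_Q ν(Q)^{-e} ∫_Q |b - ⟨b⟩_Q|` with `e = 1 + α/d`. -/
def bmoNormOn (𝒟 : Set (Cube d)) (e : ℝ) (ν b : Rd d → ℝ) : ℝ≥0∞ :=
  ⨆ (Q : Cube d) (_ : Q ∈ 𝒟), ENNReal.ofReal (osc Q b / wInt Q ν ^ e)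

/-- The Muckenhoupt `A_p` characteristic over the family `𝒟`. -/
def ApCharOn (𝒟 : Set (Cube d)) (p : ℝ) (w : Rd d → ℝ) : ℝ≥0∞ :=
  ⨆ (Q : Cube d) (_ : Q ∈ 𝒟),
    ENNReal.ofReal (avg Q w * avg Q (fun x => w x ^ (-(conj p / p))) ^ (p / conj p))

/-- `w ∈ A_p` (over the family `𝒟`). -/
def IsApOn (𝒟 : Set (Cube d)) (p : ℝ) (w : Rd d → ℝ) : Prop :=
  IsWeight w ∧ LocallyIntegrable (fun x => w x ^ (-(conj p / p))) volume ∧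
    ApCharOn 𝒟 p w < ⊤

/-- The Fujii–Wilson `A_∞` characteristic over the family `𝒟`. -/
def AinfCharOn (𝒟 : Set (Cube d)) (w : Rd d → ℝ) : ℝ≥0∞ :=
  ⨆ (Q : Cube d) (_ : Q ∈ 𝒟),
    (∫⁻ x in Q.carrier,
        ⨆ (R : Cube d) (_ : R ∈ 𝒟) (_ : x ∈ R.carrier),
          ENNReal.ofReal ((∫ y in Q.carrier ∩ R.carrier, w y) / R.vol)) /
      ENNReal.ofReal (wInt Q w)

/-- The relative Fujii–Wilson characteristic `[w]_{A_∞(ν)}` over the family `𝒟`. -/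
def relAinfOn (𝒟 : Set (Cube d)) (w ν : Rd d → ℝ) : ℝ≥0∞ :=
  ⨆ (Q : Cube d) (_ : Q ∈ 𝒟),
    (∫⁻ x in Q.carrier,
        (⨆ (R : Cube d) (_ : R ∈ 𝒟) (_ : R.carrier ⊆ Q.carrier) (_ : x ∈ R.carrier),
          ENNReal.ofReal (wInt R w / wInt R ν)) * ENNReal.ofReal (ν x)) /
      ENNReal.ofReal (wInt Q w)

/-- The joint Bloom–Muckenhoupt characteristic `[μ',λ,ν]_{B_{p',q}}` (for upper bounds). -/
def BupperOn (𝒟 : Set (Cube d)) (p q : ℝ) (μ' lam ν : Rd d → ℝ) : ℝ≥0∞ :=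
  ⨆ (Q : Cube d) (_ : Q ∈ 𝒟),
    ENNReal.ofReal (avg Q μ' ^ (1 / conj p) * avg Q lam ^ (1 / q) *
      avg Q ν ^ (1 / p + 1 / conj q))

/-- The joint Bloom–Muckenhoupt characteristic `[μ,λ']_{B_{p,q'}(ν)}` (for lower bounds). -/
def BlowerOn (𝒟 : Set (Cube d)) (p q : ℝ) (μ lam' ν : Rd d → ℝ) : ℝ≥0∞ :=
  ⨆ (Q : Cube d) (_ : Q ∈ 𝒟),
    ENNReal.ofReal ((wInt Q μ / wInt Q ν) ^ (1 / p) * (wInt Q lam' / wInt Q ν) ^ (1 / conj q))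

/-- A doubling weight. -/
def DoublingWeight (w : Rd d → ℝ) : Prop :=
  ∃ C : ℝ, 0 < C ∧ ∀ Q : Cube d, wInt Q.double w ≤ C * wInt Q w

/-- A `(γ, ν)`-sparse collection of cubes (with respect to a weight `ν`). -/
def SparseFamily (γ : ℝ) (ν : Rd d → ℝ) (S : Set (Cube d)) : Prop :=
  ∃ E : Cube d → Set (Rd d),
    (∀ Q ∈ S, E Q ⊆ Q.carrier ∧ MeasurableSet (E Q) ∧ γ * wInt Q ν ≤ ∫ x in E Q, ν x) ∧
    S.Pairwise fun Q R => Disjoint (E Q) (E R)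

/-- A `(γ, ν)`-sparse collection of cubes (with respect to a measure `ν`). -/
def MSparseFamily (γ : ℝ) (ν : Measure (Rd d)) (S : Set (Cube d)) : Prop :=
  ∃ E : Cube d → Set (Rd d),
    (∀ Q ∈ S, E Q ⊆ Q.carrier ∧ ENNReal.ofReal γ * ν Q.carrier ≤ ν (E Q)) ∧
    S.Pairwise fun Q R => Disjoint (E Q) (E R)

/-- The weighted sharp maximal function with respect to a measure `ν`. -/
def mSharpMaxOn (𝒟 : Set (Cube d)) (ν : Measure (Rd d)) (b : Rd d → ℝ) (x : Rd d) : ℝ≥0∞ :=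
  ⨆ (Q : Cube d) (_ : Q ∈ 𝒟) (_ : x ∈ Q.carrier), ENNReal.ofReal (osc Q b) / ν Q.carrier

/-- The distance between two sets in `ℝ^d`. -/
def setDist (s t : Set (Rd d)) : ℝ := sInf {r | ∃ x ∈ s, ∃ y ∈ t, r = dist x y}

/-- Supports separated by a positive distance. -/
def SeparatedSupports (f g : Rd d → ℝ) : Prop :=
  ∃ ε : ℝ, 0 < ε ∧ ∀ x ∈ tsupport f, ∀ y ∈ tsupport g, ε ≤ dist x y

/-- A dyadic lattice on `ℝ^d`: for every `k ∈ ℤ` a partition of `ℝ^d` into cubes of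
side length `2^{-k}`, each refining the previous one. -/
structure DyadicLattice (d : ℕ) where
  layer : ℤ → Set (Cube d)
  side_eq : ∀ k : ℤ, ∀ Q ∈ layer k, Q.side = (2 : ℝ) ^ (-k)
  covers : ∀ k : ℤ, ∀ x : Rd d, ∃ Q ∈ layer k, x ∈ Q.carrier
  pairwiseDisjoint : ∀ k : ℤ, ∀ Q ∈ layer k, ∀ R ∈ layer k,
    Q ≠ R → Q.carrier ∩ R.carrier = ∅
  refines : ∀ k : ℤ, ∀ Q ∈ layer (k + 1), ∃ R ∈ layer k, Q.carrier ⊆ R.carrier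

/-- The cubes of a dyadic lattice. -/
def DyadicLattice.cubes (D : DyadicLattice d) : Set (Cube d) := {Q | ∃ k, Q ∈ D.layer k}

/-- `𝒟(Q₀)`: the dyadic cubes contained in `Q₀`. -/
def DyadicLattice.below (D : DyadicLattice d) (Q₀ : Cube d) : Set (Cube d) :=
  {Q ∈ D.cubes | Q.carrier ⊆ Q₀.carrier}

open Classical in
/-- The martingale difference `D_Q b = Σ_{R : R̂ = Q} ⟨b⟩_R 1_R − ⟨b⟩_Q 1_Q`. -/
def DyadicLattice.DQ (D : DyadicLattice d) (Q : Cube d) (b : Rd d → ℝ) (x : Rd d) : ℝ :=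
  if h : x ∈ Q.carrier ∧
      ∃ R, R ∈ D.cubes ∧ R.side = Q.side / 2 ∧ x ∈ R.carrier ∧ R.carrier ⊆ Q.carrier
  then avg h.2.choose b - avg Q b
  else 0

/-- Finite partial sums `Σ_{Q ∈ F} D_Q b ⟨f⟩_Q` of the paraproduct. -/
def parasum (D : DyadicLattice d) (b f : Rd d → ℝ) (F : Finset (Cube d)) (x : Rd d) : ℝ :=
  ∑ Q ∈ F, D.DQ Q b x * avg Q f

/-- Unconditional convergence of the paraproduct sum in `L¹_loc` to the function `S`. -/
def UncondConvL1loc (D : DyadicLattice d) (b f S : Rd d → ℝ) : Prop :=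
  ∀ K : Set (Rd d), IsCompact K → ∀ ε : ℝ, 0 < ε →
    ∃ F₀ : Finset (Cube d), ↑F₀ ⊆ D.cubes ∧
      ∀ F : Finset (Cube d), ↑F ⊆ D.cubes → F₀ ⊆ F →
        ∫ x in K, |parasum D b f F x - S x| < ε

/-- `P` is the dyadic paraproduct `Π_b` associated to `b` and the lattice `D`. -/
def IsParaproduct (D : DyadicLattice d) (b : Rd d → ℝ) (P : (Rd d → ℝ) → Rd d → ℝ) : Prop :=
  ∀ f : Rd d → ℝ, BddCompactSupp f → UncondConvL1loc D b f (P f)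

/-- Unconditional convergence of the paraproduct sum in `L^q(λ)` to the function `S`. -/
def UncondConvLq (D : DyadicLattice d) (q : ℝ) (lam : Rd d → ℝ) (b f S : Rd d → ℝ) : Prop :=
  ∀ ε : ℝ, 0 < ε →
    ∃ F₀ : Finset (Cube d), ↑F₀ ⊆ D.cubes ∧
      ∀ F : Finset (Cube d), ↑F ⊆ D.cubes → F₀ ⊆ F →
        wnorm q lam (fun x => parasum D b f F x - S x) < ENNReal.ofReal ε

/-- A modulus of continuity: increasing with `ω(t) → 0` as `t → 0`. -/
def ModulusOfContinuity (ω : ℝ → ℝ) : Prop :=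
  Monotone ω ∧ (∀ t, 0 ≤ ω t) ∧ Tendsto ω (nhdsWithin 0 (Ioi 0)) (nhds 0)

/-- The Dini condition `∫₀¹ ω(t)/t dt < ∞`. -/
def DiniCondition (ω : ℝ → ℝ) : Prop :=
  IntegrableOn (fun t => ω t / t) (Ioc (0 : ℝ) 1) volume

/-- An `ω`-Calderón–Zygmund kernel. -/
structure CZKernel (d : ℕ) (ω : ℝ → ℝ) where
  kernel : Rd d → Rd d → ℝ
  CK : ℝ
  CK_pos : 0 < CK
  size : ∀ x y : Rd d, x ≠ y → |kernel x y| ≤ CK / dist x y ^ d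
  smooth : ∀ x x' y : Rd d, x ≠ y → dist x x' ≤ dist x y / 2 →
    |kernel x y - kernel x' y| + |kernel y x - kernel y x'| ≤
      1 / dist x y ^ d * ω (dist x x' / dist x y)

/-- Non-degeneracy of a Calderón–Zygmund kernel. -/
def CZKernel.NonDegenerate {d : ℕ} {ω : ℝ → ℝ} (K : CZKernel d ω) : Prop :=
  ∃ c : ℝ, 0 < c ∧ ∀ (x : Rd d) (r : ℝ), 0 < r →
    ∃ y : Rd d, c * r ≤ dist x y ∧ c / r ^ d ≤ |K.kernel y x|

/-- An `ω`-Calderón–Zygmund operator: a linear operator, bounded on some `L^{p₀}`, with an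
`ω`-Calderón–Zygmund kernel representation off the support. -/
structure CZOperator (d : ℕ) (ω : ℝ → ℝ) extends CZKernel d ω where
  T : (Rd d → ℝ) → Rd d → ℝ
  map_add : ∀ f g : Rd d → ℝ, T (f + g) = T f + T g
  map_smul : ∀ (c : ℝ) (f : Rd d → ℝ), T (c • f) = c • T f
  measurable_map : ∀ f : Rd d → ℝ, Measurable f → Measurable (T f)
  p₀ : ℝ
  one_lt_p₀ : 1 < p₀
  N₀ : ℝ
  bounded : ∀ f : Rd d → ℝ, Measurable f →
    wnorm p₀ (fun _ => 1) (T f) ≤ ENNReal.ofReal N₀ * wnorm p₀ (fun _ => 1) f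
  kernel_repr : ∀ f : Rd d → ℝ, BddCompactSupp f → ∀ x ∉ tsupport f,
    T f x = ∫ y, kernel x y * f y

/-- The commutator `[b, T] f = b · Tf − T(b f)`. -/
def commutatorOp (b : Rd d → ℝ) (T : (Rd d → ℝ) → Rd d → ℝ) : (Rd d → ℝ) → Rd d → ℝ :=
  fun f x => b x * T f x - T (fun y => b y * f y) x

/-- The sparse operator `𝒜^⋆_{S,b} f = Σ_{Q∈S} ⟨|b − ⟨b⟩_Q| |f|⟩_Q 1_Q`. -/
def sparseOpStar (S : Set (Cube d)) (b f : Rd d → ℝ) (x : Rd d) : ℝ≥0∞ :=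
  ∑' Q : S, (Q : Cube d).carrier.indicator
      (fun _ => ENNReal.ofReal (avg (Q : Cube d) fun y => |b y - avg (Q : Cube d) b| * |f y|)) x

/-- The sparse operator `f ↦ Σ_{Q∈S} ⟨|b − ⟨b⟩_Q|⟩_Q ⟨|f|⟩_Q 1_Q`. -/
def sparseOp2 (S : Set (Cube d)) (b f : Rd d → ℝ) (x : Rd d) : ℝ≥0∞ :=
  ∑' Q : S, (Q : Cube d).carrier.indicator
      (fun _ => ENNReal.ofReal ((avg (Q : Cube d) fun y => |b y - avg (Q : Cube d) b|) *
        avg (Q : Cube d) fun y => |f y|)) x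

/-- The sparse operator `f ↦ Σ_{Q∈S} (|Q|^{-s} ∫_Q |f|^s)^{1/s} 1_Q`. -/
def sparseOpPow (S : Set (Cube d)) (s : ℝ) (f : Rd d → ℝ) (x : Rd d) : ℝ≥0∞ :=
  ∑' Q : S, (Q : Cube d).carrier.indicator
      (fun _ => ENNReal.ofReal (((Q : Cube d).vol ^ (-s) *
        intC (Q : Cube d) fun y => |f y| ^ s) ^ (1 / s))) x

section WeakToStrong

variable {X : Type*} [MeasurableSpace X]

/-- Layer-cake form of Doob's inequality: a weak-type estimate of `V` by `N` on the level sets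
of `g` controls the `(s + 1)`-st moment under `V` by the `s`-th moment under `N`. -/
theorem lintegral_rpow_add_one_le_of_weakType {N V : Measure X} {s : ℝ} (hs : 0 < s)
    {g : X → ℝ} (hg : Measurable g) (hg0 : ∀ x, 0 ≤ g x)
    (hw : ∀ t : ℝ, 0 < t → ENNReal.ofReal t * V {x | t < g x} ≤ N {x | t < g x}) :
    ∫⁻ x, ENNReal.ofReal (g x ^ (s + 1)) ∂V ≤
      ENNReal.ofReal ((s + 1) / s) * ∫⁻ x, ENNReal.ofReal (g x ^ s) ∂N := by
  have hs1 : 0 < s + 1 := by linarith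
  rw [lintegral_rpow_eq_lintegral_meas_lt_mul V (.of_forall hg0) hg.aemeasurable hs1,
    lintegral_rpow_eq_lintegral_meas_lt_mul N (.of_forall hg0) hg.aemeasurable hs,
    ← mul_assoc, ← ENNReal.ofReal_mul (by positivity), div_mul_cancel₀ _ hs.ne']
  refine mul_le_mul_right ?_ _
  refine setLIntegral_mono' measurableSet_Ioi fun t (ht : 0 < t) => ?_
  calc V {x | t < g x} * ENNReal.ofReal (t ^ (s + 1 - 1))
      = ENNReal.ofReal t * V {x | t < g x} * ENNReal.ofReal (t ^ (s - 1)) := by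
        rw [mul_comm (ENNReal.ofReal t), mul_assoc, ← ENNReal.ofReal_mul ht.le]
        congr 2
        rw [add_sub_cancel_right, ← Real.rpow_one_add' ht.le (by linarith)]
        congr 1
        ring
    _ ≤ _ := by gcongr; exact hw t ht

/-- The strong-type estimate behind the relative `A_∞` bound: if `M` is of weak type relative to
the densities `v, ν`, and `y ^ s ν ≤ c y ^ (s + 1) v + K u` with `c` small, then
`∫ M ^ s ν ≤ 2 K ∫ u`. -/
theorem lintegral_rpow_mul_le_of_weakType {m : Measure X} {u v ν : X → ℝ}
    (hu : Measurable u) (hv : Measurable v) (hν : Measurable ν)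
    (hfin : ∫⁻ x, ENNReal.ofReal (ν x) ∂m ≠ ⊤) {s K : ℝ} (hs : 0 < s) (hK : 0 ≤ K)
    (hpt : ∀ x, ∀ y : ℝ, 0 ≤ y →
      y ^ s * ν x ≤ s / (2 * (s + 1)) * (y ^ (s + 1) * v x) + K * u x)
    {M : X → ℝ≥0∞} (hM : Measurable M)
    (hw : ∀ t : ℝ, 0 < t →
      ENNReal.ofReal t * m.withDensity (fun x => ENNReal.ofReal (v x)) {x | ENNReal.ofReal t < M x}
        ≤ m.withDensity (fun x => ENNReal.ofReal (ν x)) {x | ENNReal.ofReal t < M x}) :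
    ∫⁻ x, M x ^ s * ENNReal.ofReal (ν x) ∂m ≤
      ENNReal.ofReal (2 * K) * ∫⁻ x, ENNReal.ofReal (u x) ∂m := by
  have htrunc : ∀ n : ℕ, ∫⁻ x, min (M x) n ^ s * ENNReal.ofReal (ν x) ∂m ≤
      ENNReal.ofReal (2 * K) * ∫⁻ x, ENNReal.ofReal (u x) ∂m := by
    intro n
    have hne : ∀ x, min (M x) n ≠ ⊤ := fun x =>
      ne_top_of_le_ne_top (ENNReal.natCast_ne_top n) (min_le_right _ _)
    let g : X → ℝ := fun x => (min (M x) n).toReal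
    have hg0 : ∀ x, 0 ≤ g x := fun x => ENNReal.toReal_nonneg
    have hg : Measurable g := (hM.min measurable_const).ennreal_toReal
    have hgpow : ∀ x, min (M x) n ^ s = ENNReal.ofReal (g x ^ s) := fun x => by
      rw [← ENNReal.ofReal_rpow_of_nonneg (hg0 x) hs.le, ENNReal.ofReal_toReal (hne x)]
    have hlt : ∀ x t, 0 < t → (t < g x ↔ ENNReal.ofReal t < M x ∧ ENNReal.ofReal t < n) :=
      fun x t ht => by rw [← ENNReal.ofReal_lt_iff_lt_toReal ht.le (hne x), lt_min_iff]
    have hdoob := lintegral_rpow_add_one_le_of_weakType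
      (N := m.withDensity fun x => ENNReal.ofReal (ν x))
      (V := m.withDensity fun x => ENNReal.ofReal (v x)) hs hg hg0 (fun t ht => by
        by_cases htn : ENNReal.ofReal t < n
        · simpa [hlt _ _ ht, htn] using hw t ht
        · simp [hlt _ _ ht, htn])
    rw [lintegral_withDensity_eq_lintegral_mul _ hv.ennreal_ofReal
        (hg.pow_const _).ennreal_ofReal,
      lintegral_withDensity_eq_lintegral_mul _ hν.ennreal_ofReal
        (hg.pow_const _).ennreal_ofReal] at hdoob
    simp only [Pi.mul_apply] at hdoob
    have hXeq : ∫⁻ x, min (M x) n ^ s * ENNReal.ofReal (ν x) ∂m =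
        ∫⁻ x, ENNReal.ofReal (ν x) * ENNReal.ofReal (g x ^ s) ∂m := by
      simp_rw [hgpow, mul_comm]
    have hXfin : ∫⁻ x, min (M x) n ^ s * ENNReal.ofReal (ν x) ∂m ≠ ⊤ := by
      have hle : ∫⁻ x, min (M x) n ^ s * ENNReal.ofReal (ν x) ∂m ≤
          ∫⁻ x, (n : ℝ≥0∞) ^ s * ENNReal.ofReal (ν x) ∂m := by
        gcongr
        exact min_le_right _ _
      rw [lintegral_const_mul _ hν.ennreal_ofReal] at hle
      exact ne_top_of_le_ne_top (ENNReal.mul_ne_top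
        (ENNReal.rpow_ne_top_of_nonneg hs.le (ENNReal.natCast_ne_top n)) hfin) hle
    rw [hXeq] at hXfin ⊢
    set I := ∫⁻ x, ENNReal.ofReal (ν x) * ENNReal.ofReal (g x ^ s) ∂m
    set U := ∫⁻ x, ENNReal.ofReal (u x) ∂m
    have hsplit : I ≤ ENNReal.ofReal (1 / 2) * I + ENNReal.ofReal K * U := by
      calc I ≤ ∫⁻ x, (ENNReal.ofReal (s / (2 * (s + 1))) *
              (ENNReal.ofReal (v x) * ENNReal.ofReal (g x ^ (s + 1))) +
              ENNReal.ofReal K * ENNReal.ofReal (u x)) ∂m := by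
            refine lintegral_mono fun x => ?_
            have hp := hpt x (g x) (hg0 x)
            have hgs := Real.rpow_nonneg (hg0 x) s
            have hgs1 := Real.rpow_nonneg (hg0 x) (s + 1)
            calc ENNReal.ofReal (ν x) * ENNReal.ofReal (g x ^ s)
                = ENNReal.ofReal (g x ^ s * ν x) := by rw [ENNReal.ofReal_mul hgs, mul_comm]
              _ ≤ _ := ENNReal.ofReal_le_ofReal hp
              _ ≤ _ := ENNReal.ofReal_add_le
              _ = _ := by
                rw [ENNReal.ofReal_mul (by positivity), ENNReal.ofReal_mul hgs1,
                  ENNReal.ofReal_mul hK, mul_comm (ENNReal.ofReal (v x))]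
        _ = ENNReal.ofReal (s / (2 * (s + 1))) *
              ∫⁻ x, ENNReal.ofReal (v x) * ENNReal.ofReal (g x ^ (s + 1)) ∂m +
              ENNReal.ofReal K * U := by
            rw [lintegral_add_right _ (hu.ennreal_ofReal.const_mul _),
              lintegral_const_mul _ hu.ennreal_ofReal,
              lintegral_const_mul' _ _ ENNReal.ofReal_ne_top]
        _ ≤ ENNReal.ofReal (s / (2 * (s + 1))) * (ENNReal.ofReal ((s + 1) / s) * I) +
              ENNReal.ofReal K * U := by gcongr
        _ = _ := by
            rw [← mul_assoc, ← ENNReal.ofReal_mul (by positivity)]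
            congr 3
            field_simp
    have hhalf : I = ENNReal.ofReal (1 / 2) * I + ENNReal.ofReal (1 / 2) * I := by
      rw [← add_mul, ← ENNReal.ofReal_add (by norm_num) (by norm_num)]
      norm_num
    have hle : ENNReal.ofReal (1 / 2) * I ≤ ENNReal.ofReal K * U := by
      have hne' : ENNReal.ofReal (1 / 2) * I ≠ ⊤ := ENNReal.mul_ne_top ENNReal.ofReal_ne_top hXfin
      rw [← ENNReal.add_le_add_iff_left hne', ← hhalf]
      exact hsplit
    calc I = ENNReal.ofReal 2 * (ENNReal.ofReal (1 / 2) * I) := by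
          rw [← mul_assoc, ← ENNReal.ofReal_mul (by norm_num)]
          norm_num
      _ ≤ ENNReal.ofReal 2 * (ENNReal.ofReal K * U) := by gcongr
      _ = _ := by rw [← mul_assoc, ← ENNReal.ofReal_mul (by norm_num)]
  have hsup : ∀ x, M x ^ s * ENNReal.ofReal (ν x) ≤
      liminf (fun n : ℕ => min (M x) n ^ s * ENNReal.ofReal (ν x)) atTop := by
    intro x
    have hmin : Tendsto (fun n : ℕ => min (M x) (n : ℝ≥0∞)) atTop (nhds (M x)) := by
      simpa using (tendsto_const_nhds (x := M x)).min ENNReal.tendsto_nat_nhds_top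
    exact (ENNReal.Tendsto.mul_const ((ENNReal.continuous_rpow_const.tendsto _).comp hmin)
      (Or.inr ENNReal.ofReal_ne_top)).liminf_eq.ge
  calc ∫⁻ x, M x ^ s * ENNReal.ofReal (ν x) ∂m
      ≤ ∫⁻ x, liminf (fun n : ℕ => min (M x) n ^ s * ENNReal.ofReal (ν x)) atTop ∂m :=
        lintegral_mono hsup
    _ ≤ liminf (fun n : ℕ => ∫⁻ x, min (M x) n ^ s * ENNReal.ofReal (ν x) ∂m) atTop :=
        lintegral_liminf_le fun n =>
          ((hM.min measurable_const).pow_const s).mul hν.ennreal_ofReal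
    _ ≤ _ := liminf_le_of_le (h := fun b hb => by
        obtain ⟨n, hn⟩ := hb.exists
        exact hn.trans (htrunc n))

/-- A comparison of two measures on the members of a countable laminar family of sets passes to
the union of the family. -/
theorem mul_measure_biUnion_le_of_laminar {ι : Type*} {N V : Measure X} {c : ℝ≥0∞}
    {A : ι → Set X} {S : Set ι} (hS : S.Countable) (hA : ∀ i ∈ S, MeasurableSet (A i))
    (hlam : ∀ i ∈ S, ∀ j ∈ S, A i ⊆ A j ∨ A j ⊆ A i ∨ Disjoint (A i) (A j))
    (hle : ∀ i ∈ S, c * V (A i) ≤ N (A i)) :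
    c * V (⋃ i ∈ S, A i) ≤ N (⋃ i ∈ S, A i) := by
  classical
  have hfinite : ∀ F : Finset ι, ↑F ⊆ S → c * V (⋃ i ∈ F, A i) ≤ N (⋃ i ∈ F, A i) := by
    intro F
    induction F using Finset.strongInduction with
    | H F ih =>
      intro hF
      rcases F.eq_empty_or_nonempty with rfl | hne
      · simp
      obtain ⟨i, hi, hmax⟩ := Finset.exists_maximalFor A F hne
      set G := F.filter fun j => ¬ A j ⊆ A i with hG
      have hGF : G ⊂ F := Finset.filter_ssubset.2 ⟨i, hi, by simp⟩
      have hU : ⋃ j ∈ F, A j = A i ∪ ⋃ j ∈ G, A j := by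
        ext x
        simp only [mem_iUnion, mem_union, hG, Finset.mem_filter, exists_prop]
        constructor
        · rintro ⟨j, hj, hx⟩
          by_cases h : A j ⊆ A i
          · exact Or.inl (h hx)
          · exact Or.inr ⟨j, ⟨hj, h⟩, hx⟩
        · rintro (hx | ⟨j, ⟨hj, -⟩, hx⟩)
          · exact ⟨i, hi, hx⟩
          · exact ⟨j, hj, hx⟩
      have hdisj : Disjoint (A i) (⋃ j ∈ G, A j) := by
        simp only [disjoint_iUnion_right]
        intro j hj
        obtain ⟨hjF, hj⟩ := Finset.mem_filter.1 hj
        rcases hlam i (hF hi) j (hF hjF) with h | h | h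
        · exact absurd (hmax hjF h) hj
        · exact absurd h hj
        · exact h
      rw [hU, measure_union' hdisj (hA i (hF hi)), measure_union' hdisj (hA i (hF hi)), mul_add]
      exact add_le_add (hle i (hF hi))
        (ih G hGF fun j hj => hF (hGF.subset hj))
  have : Countable S := hS.to_subtype
  have hdir : Directed (· ⊆ ·) fun F : Finset S => ⋃ i ∈ F, A i :=
    Monotone.directed_le fun F G h => biUnion_subset_biUnion_left h
  have hU : ⋃ i ∈ S, A i = ⋃ F : Finset S, ⋃ i ∈ F, A i := by
    rw [biUnion_eq_iUnion, iUnion_eq_iUnion_finset]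
  rw [hU, hdir.measure_iUnion, ENNReal.mul_iSup]
  refine iSup_le fun F => ?_
  have hF : ⋃ i ∈ F.map (Function.Embedding.subtype _), A i = ⋃ i ∈ F, A (i : ι) := by
    ext x
    simp
  have h := hfinite (F.map (Function.Embedding.subtype _)) (by simp)
  rw [hF] at h
  exact h.trans (measure_mono (subset_iUnion (fun F : Finset S => ⋃ i ∈ F, A i) F))

end WeakToStrong

/-- The pointwise splitting used to absorb `∫ M ^ s ν`. -/
theorem rpow_mul_le_of_rpow_add_eq {a b c u v ν y : ℝ} (ha : 0 < a) (hb : 0 < b) (hc : 0 < c)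
    (hu : 0 < u) (hv : 0 < v) (hν : 0 < ν) (hy : 0 ≤ y) (h : ν ^ (a + b) = u ^ a * v ^ b) :
    y ^ (b / a) * ν ≤ c * (y ^ (b / a + 1) * v) + (1 / c) ^ (b / a) * u := by
  have hs : 0 < b / a := by positivity
  have hys := Real.rpow_nonneg hy (b / a)
  rcases le_or_gt ν (c * y * v) with hle | hlt
  · have h1 : y ^ (b / a + 1) = y ^ (b / a) * y := Real.rpow_add_one' hy (by linarith)
    have h2 : 0 ≤ (1 / c) ^ (b / a) * u := by positivity
    have h3 := mul_le_mul_of_nonneg_left hle hys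
    rw [h1]
    linarith
  · have hu' : u = (ν / v) ^ (b / a) * ν := by
      have h1 : u ^ a = ((ν / v) ^ (b / a) * ν) ^ a := by
        rw [Real.mul_rpow (by positivity) hν.le, ← Real.rpow_mul (by positivity),
          div_mul_cancel₀ _ ha.ne', Real.div_rpow hν.le hv.le, div_mul_eq_mul_div,
          ← Real.rpow_add hν, add_comm b a, h]
        field_simp
      exact (Real.rpow_left_inj hu.le (by positivity) ha.ne').1 h1
    have hy' : y ≤ 1 / c * (ν / v) := by
      rw [div_mul_div_comm, one_mul, le_div_iff₀ (by positivity)]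
      linarith
    have h2 : 0 ≤ c * (y ^ (b / a + 1) * v) := by positivity
    have h3 : y ^ (b / a) * ν ≤ (1 / c) ^ (b / a) * u := by
      rw [hu', ← mul_assoc, ← Real.mul_rpow (by positivity) (by positivity)]
      gcongr
    linarith

namespace Cube

theorem measurableSet_carrier (Q : Cube d) : MeasurableSet Q.carrier := by
  have : Q.carrier = ⋂ i, {x : Rd d | Q.corner i ≤ x i ∧ x i < Q.corner i + Q.side} := by
    ext; simp [carrier]
  rw [this]
  refine MeasurableSet.iInter fun i => ?_
  have hi : Measurable fun x : Rd d => x i := by fun_prop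
  exact (measurableSet_le measurable_const hi).inter (measurableSet_lt hi measurable_const)

theorem nonempty_interior_carrier (Q : Cube d) : (interior Q.carrier).Nonempty := by
  have hs := Q.side_pos
  refine ⟨WithLp.toLp 2 fun i => Q.corner i + Q.side / 2, mem_interior.2
    ⟨⋂ i, {x : Rd d | Q.corner i < x i ∧ x i < Q.corner i + Q.side}, ?_, ?_, ?_⟩⟩
  · intro x hx i
    have := mem_iInter.1 hx i
    exact ⟨this.1.le, this.2⟩
  · refine isOpen_iInter_of_finite fun i => ?_
    have hi : Continuous fun x : Rd d => x i := by fun_prop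
    exact (isOpen_lt continuous_const hi).inter (isOpen_lt hi continuous_const)
  · refine mem_iInter.2 fun i => ⟨?_, ?_⟩ <;> simp <;> linarith

theorem isBounded_carrier (Q : Cube d) : Bornology.IsBounded Q.carrier := by
  have hb : Bornology.IsBounded
      (univ.pi fun i => Icc (Q.corner i) (Q.corner i + Q.side)) :=
    Bornology.IsBounded.pi fun i => Metric.isBounded_Icc _ _
  refine ((PiLp.antilipschitzWith_ofLp 2 fun _ : Fin d => ℝ).isBounded_preimage hb).subset ?_
  intro x hx i _
  exact ⟨(hx i).1, (hx i).2.le⟩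

theorem integrableOn_carrier (Q : Cube d) {w : Rd d → ℝ} (hw : LocallyIntegrable w volume) :
    IntegrableOn w Q.carrier :=
  (hw.integrableOn_isCompact Q.isBounded_carrier.isCompact_closure).mono_set subset_closure

theorem wInt_pos (Q : Cube d) {w : Rd d → ℝ} (hw : IsWeight w) : 0 < wInt Q w := by
  have hsupp : Function.support w = univ := by
    ext x; simpa using (hw.1 x).ne'
  refine (setIntegral_pos_iff_support_of_nonneg_ae (.of_forall fun x => (hw.1 x).le)
    (Q.integrableOn_carrier hw.2.2)).2 ?_
  rw [hsupp, univ_inter]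
  exact Measure.measure_pos_of_nonempty_interior _ Q.nonempty_interior_carrier

theorem ofReal_wInt (Q : Cube d) {w : Rd d → ℝ} (hw : IsWeight w) :
    ENNReal.ofReal (wInt Q w) = ∫⁻ x in Q.carrier, ENNReal.ofReal (w x) :=
  ofReal_integral_eq_lintegral_ofReal (Q.integrableOn_carrier hw.2.2)
    (.of_forall fun x => (hw.1 x).le)

end Cube

namespace DyadicLattice

theorem countable_cubes (D : DyadicLattice d) : D.cubes.Countable := by
  have : D.cubes = ⋃ k, D.layer k := by ext; simp [cubes]
  rw [this]
  refine countable_iUnion fun k => PairwiseDisjoint.countable_of_nonempty_interior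
    (s := Cube.carrier) (fun Q hQ R hR hne => ?_) fun Q _ => Q.nonempty_interior_carrier
  exact disjoint_iff_inter_eq_empty.2 (D.pairwiseDisjoint k Q hQ R hR hne)

theorem exists_ancestor (D : DyadicLattice d) (k : ℤ) (n : ℕ) {Q : Cube d}
    (hQ : Q ∈ D.layer (k + n)) : ∃ R ∈ D.layer k, Q.carrier ⊆ R.carrier := by
  induction n generalizing Q with
  | zero => exact ⟨Q, by simpa using hQ, subset_rfl⟩
  | succ n ih =>
    obtain ⟨R, hR, hQR⟩ := D.refines (k + n) Q (by rwa [Nat.cast_succ, ← add_assoc] at hQ)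
    obtain ⟨P, hP, hRP⟩ := ih hR
    exact ⟨P, hP, hQR.trans hRP⟩

theorem subset_or_disjoint_of_le (D : DyadicLattice d) {k l : ℤ} (hkl : k ≤ l) {Q R : Cube d}
    (hQ : Q ∈ D.layer k) (hR : R ∈ D.layer l) :
    R.carrier ⊆ Q.carrier ∨ Disjoint R.carrier Q.carrier := by
  obtain ⟨n, rfl⟩ := Int.le.dest hkl
  obtain ⟨P, hP, hRP⟩ := D.exists_ancestor k n hR
  by_cases h : P = Q
  · exact Or.inl (h ▸ hRP)
  · exact Or.inr ((disjoint_iff_inter_eq_empty.2 (D.pairwiseDisjoint k P hP Q hQ h)).mono_left hRP)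

/-- The cubes of a dyadic lattice form a laminar family. -/
theorem subset_or_subset_or_disjoint (D : DyadicLattice d) {Q R : Cube d}
    (hQ : Q ∈ D.cubes) (hR : R ∈ D.cubes) :
    Q.carrier ⊆ R.carrier ∨ R.carrier ⊆ Q.carrier ∨ Disjoint Q.carrier R.carrier := by
  obtain ⟨k, hQ⟩ := hQ
  obtain ⟨l, hR⟩ := hR
  rcases le_total k l with h | h
  · rcases D.subset_or_disjoint_of_le h hQ hR with h | h
    · exact Or.inr (Or.inl h)
    · exact Or.inr (Or.inr h.symm)
  · rcases D.subset_or_disjoint_of_le h hR hQ with h | h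
    · exact Or.inl h
    · exact Or.inr (Or.inr h)

/-- The maximal function `sup_{R ∈ 𝒟(Q), x ∈ R} ν(R) / v(R)`. -/
def relMax (D : DyadicLattice d) (Q : Cube d) (ν v : Rd d → ℝ) (x : Rd d) : ℝ≥0∞ :=
  ⨆ R ∈ D.below Q, R.carrier.indicator (fun _ => ENNReal.ofReal (wInt R ν / wInt R v)) x

theorem countable_below (D : DyadicLattice d) (Q : Cube d) : (D.below Q).Countable :=
  D.countable_cubes.mono fun _ h => h.1

theorem measurable_relMax (D : DyadicLattice d) (Q : Cube d) (ν v : Rd d → ℝ) :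
    Measurable (D.relMax Q ν v) :=
  Measurable.biSup _ (D.countable_below Q) fun R _ =>
    measurable_const.indicator R.measurableSet_carrier

theorem relMax_weakType (D : DyadicLattice d) (Q : Cube d) {ν v : Rd d → ℝ} (hν : IsWeight ν)
    (hv : IsWeight v) {t : ℝ} (ht : 0 < t) :
    ENNReal.ofReal t * (volume.restrict Q.carrier).withDensity (fun x => ENNReal.ofReal (v x))
        {x | ENNReal.ofReal t < D.relMax Q ν v x} ≤
      (volume.restrict Q.carrier).withDensity (fun x => ENNReal.ofReal (ν x))
        {x | ENNReal.ofReal t < D.relMax Q ν v x} := by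
  set S := {R ∈ D.below Q | t < wInt R ν / wInt R v}
  have hset : {x | ENNReal.ofReal t < D.relMax Q ν v x} = ⋃ R ∈ S, R.carrier := by
    ext x
    simp only [relMax, mem_ofPred_eq, lt_iSup_iff, mem_iUnion, exists_prop, S]
    refine exists_congr fun R => ?_
    by_cases hx : x ∈ R.carrier
    · simp [hx, ENNReal.ofReal_lt_ofReal_iff_of_nonneg ht.le]
    · simp [hx]
  have hdens : ∀ R ∈ S, ∀ w : Rd d → ℝ, IsWeight w →
      (volume.restrict Q.carrier).withDensity (fun x => ENNReal.ofReal (w x)) R.carrier =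
        ENNReal.ofReal (wInt R w) := by
    intro R hR w hw
    rw [withDensity_apply _ R.measurableSet_carrier,
      Measure.restrict_restrict R.measurableSet_carrier, inter_eq_self_of_subset_left hR.1.2,
      R.ofReal_wInt hw]
  rw [hset]
  refine mul_measure_biUnion_le_of_laminar ((D.countable_below Q).mono fun _ h => h.1)
    (fun R _ => R.measurableSet_carrier)
    (fun R hR R' hR' => D.subset_or_subset_or_disjoint hR.1.1 hR'.1.1) fun R hR => ?_
  rw [hdens R hR v hv, hdens R hR ν hν, ← ENNReal.ofReal_mul ht.le]
  exact ENNReal.ofReal_le_ofReal ((lt_div_iff₀ (R.wInt_pos hv)).1 hR.2).le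

/-- The relative Fujii–Wilson characteristic is controlled by the joint characteristic, for a
Bloom triple `ν ^ (a + b) = u ^ a v ^ b`. -/
theorem relAinfOn_le (D : DyadicLattice d) {a b : ℝ} (ha : 0 < a) (hb : 0 < b)
    {u v ν : Rd d → ℝ} (hu : IsWeight u) (hv : IsWeight v) (hν : IsWeight ν)
    (h : ∀ x, ν x ^ (a + b) = u x ^ a * v x ^ b) :
    relAinfOn D.cubes u ν ≤
      ENNReal.ofReal (2 * (1 / (b / a / (2 * (b / a + 1)))) ^ (b / a)) *
        (⨆ (Q : Cube d) (_ : Q ∈ D.cubes),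
          ENNReal.ofReal ((wInt Q u / wInt Q ν) ^ a * (wInt Q v / wInt Q ν) ^ b)) ^ (1 / a) := by
  have hs : 0 < b / a := by positivity
  set B := ⨆ (Q : Cube d) (_ : Q ∈ D.cubes),
    ENNReal.ofReal ((wInt Q u / wInt Q ν) ^ a * (wInt Q v / wInt Q ν) ^ b)
  refine iSup₂_le fun Q hQ => ?_
  have hQu := Q.wInt_pos hu
  rw [ENNReal.div_le_iff (by simpa using hQu) ENNReal.ofReal_ne_top]
  have hratio : ∀ R ∈ D.cubes, ENNReal.ofReal (wInt R u / wInt R ν) ≤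
      B ^ (1 / a) * ENNReal.ofReal (wInt R ν / wInt R v) ^ (b / a) := by
    intro R hR
    have hRu := R.wInt_pos hu
    have hRv := R.wInt_pos hv
    have hRν := R.wInt_pos hν
    have hBR : ENNReal.ofReal ((wInt R u / wInt R ν) ^ a * (wInt R v / wInt R ν) ^ b) ≤ B :=
      le_iSup₂_of_le R hR le_rfl
    refine le_trans (le_of_eq ?_) (mul_le_mul_left
      (ENNReal.rpow_le_rpow hBR (by positivity : 0 ≤ 1 / a)) _)
    rw [ENNReal.ofReal_rpow_of_pos (by positivity), ENNReal.ofReal_rpow_of_pos (by positivity),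
      ← ENNReal.ofReal_mul (by positivity), Real.mul_rpow (by positivity) (by positivity),
      ← Real.rpow_mul (by positivity), ← Real.rpow_mul (by positivity), mul_one_div_cancel ha.ne',
      Real.rpow_one, mul_one_div, mul_assoc, ← Real.mul_rpow (by positivity) (by positivity),
      div_mul_div_comm, mul_comm (wInt R v), div_self (by positivity), Real.one_rpow, mul_one]
  have hM : ∀ x, (⨆ (R : Cube d) (_ : R ∈ D.cubes) (_ : R.carrier ⊆ Q.carrier)
        (_ : x ∈ R.carrier), ENNReal.ofReal (wInt R u / wInt R ν)) ≤
      B ^ (1 / a) * D.relMax Q ν v x ^ (b / a) := by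
    intro x
    refine iSup₂_le fun R hR => iSup₂_le fun hRQ hx => (hratio R hR).trans ?_
    gcongr
    refine le_iSup₂_of_le (f := fun R (_ : R ∈ D.below Q) => R.carrier.indicator
      (fun _ => ENNReal.ofReal (wInt R ν / wInt R v)) x) R ⟨hR, hRQ⟩ ?_
    rw [indicator_of_mem hx]
  have hstrong := lintegral_rpow_mul_le_of_weakType (m := volume.restrict Q.carrier)
    (K := (1 / (b / a / (2 * (b / a + 1)))) ^ (b / a))
    hu.2.1 hv.2.1 hν.2.1
    (by rw [← Q.ofReal_wInt hν]; exact ENNReal.ofReal_ne_top) hs (by positivity)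
    (fun x y hy => rpow_mul_le_of_rpow_add_eq ha hb (by positivity) (hu.1 x) (hv.1 x) (hν.1 x)
      hy (h x))
    (D.measurable_relMax Q ν v) (fun t ht => D.relMax_weakType Q hν hv ht)
  calc ∫⁻ x in Q.carrier, (⨆ (R : Cube d) (_ : R ∈ D.cubes) (_ : R.carrier ⊆ Q.carrier)
        (_ : x ∈ R.carrier), ENNReal.ofReal (wInt R u / wInt R ν)) * ENNReal.ofReal (ν x)
      ≤ ∫⁻ x in Q.carrier, B ^ (1 / a) *
          (D.relMax Q ν v x ^ (b / a) * ENNReal.ofReal (ν x)) := by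
        refine lintegral_mono fun x => ?_
        rw [← mul_assoc]
        exact mul_le_mul_left (hM x) _
    _ = B ^ (1 / a) * ∫⁻ x in Q.carrier, D.relMax Q ν v x ^ (b / a) * ENNReal.ofReal (ν x) :=
        lintegral_const_mul _
          (((D.measurable_relMax Q ν v).pow_const _).mul hν.2.1.ennreal_ofReal)
    _ ≤ B ^ (1 / a) * (ENNReal.ofReal (2 * (1 / (b / a / (2 * (b / a + 1)))) ^ (b / a)) *
          ENNReal.ofReal (wInt Q u)) := by
        rw [Q.ofReal_wInt hu]
        gcongr
    _ = _ := by ring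

end DyadicLattice

/-- **Lemma 2.12** (weights satisfy the `A_∞` condition with respect to their Bloom
weight). For `λ' = λ^{−q'/q}` and `ν^{1/p+1/q'} = μ^{1/p} λ^{−1/q}`, the dyadic relative
Fujii–Wilson characteristics satisfy `[μ]_{A_∞(ν)} ≲ [μ,λ']_{B_{p,q'}(ν)}^p` and
`[λ']_{A_∞(ν)} ≲ [μ,λ']_{B_{p,q'}(ν)}^{q'}`. -/
theorem stmt15 (d : ℕ) (hd : 0 < d) (p q : ℝ) (hp : 1 < p) (hq : 1 < q) :
    ∃ C : ℝ, 0 < C ∧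
      ∀ (D : DyadicLattice d) (μ lam ν lam' : Rd d → ℝ),
        IsWeight μ → IsWeight lam → IsWeight ν →
        (∀ x, lam' x = lam x ^ (-(conj q / q))) →
        LocallyIntegrable lam' volume →
        (∀ x, ν x ^ (1 / p + 1 / conj q) = μ x ^ (1 / p) * lam x ^ (-(1 / q))) →
        relAinfOn D.cubes μ ν ≤ ENNReal.ofReal C * BlowerOn D.cubes p q μ lam' ν ^ p ∧
        relAinfOn D.cubes lam' ν ≤
          ENNReal.ofReal C * BlowerOn D.cubes p q μ lam' ν ^ conj q := by
  have hp0 : 0 < p := by linarith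
  have hq0 : 0 < q := by linarith
  have hcq : 0 < conj q := div_pos hq0 (by linarith)
  have ha : 0 < 1 / p := by positivity
  have hb : 0 < 1 / conj q := by positivity
  let K : ℝ → ℝ → ℝ := fun a b => 2 * (1 / (b / a / (2 * (b / a + 1)))) ^ (b / a)
  have hK : ∀ a b : ℝ, 0 < a → 0 < b → 0 < K a b := fun a b ha hb => by positivity
  refine ⟨max (K (1 / p) (1 / conj q)) (K (1 / conj q) (1 / p)),
    lt_max_of_lt_left (hK _ _ ha hb), ?_⟩
  intro D μ lam ν lam' hμ hlam hν hlam' hloc hbloom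
  have hw : IsWeight lam' := by
    refine ⟨fun x => ?_, ?_, hloc⟩
    · rw [hlam' x]
      exact Real.rpow_pos_of_pos (hlam.1 x) _
    · rw [funext hlam']
      exact hlam.2.1.pow_const _
  have hpow : ∀ x, lam x ^ (-(1 / q)) = lam' x ^ (1 / conj q) := fun x => by
    rw [hlam' x, ← Real.rpow_mul (hlam.1 x).le]
    congr 1
    field_simp
  simp only [hpow] at hbloom
  constructor
  · have h := D.relAinfOn_le ha hb hμ hw hν hbloom
    rw [one_div_one_div] at h
    refine h.trans ?_
    unfold BlowerOn
    gcongr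
    exact le_max_left _ _
  · have h := D.relAinfOn_le hb ha hw hμ hν fun x => by rw [add_comm, hbloom x, mul_comm]
    rw [one_div_one_div] at h
    refine h.trans (mul_le_mul' (ENNReal.ofReal_le_ofReal (le_max_right _ _))
      (ENNReal.rpow_le_rpow (iSup₂_mono fun Q _ => ?_) hcq.le))
    rw [mul_comm]
end
end

section
/- Let b ∈ L^1_loc, 1<r<∞ and ν ∈ A_{r'}. If there is a constant C such that ‖(b − ⟨b⟩_Q) ν^{−1}‖_{L^r(ν 1_Q)} ≤ C for all cubes Q, then there exists a constant c such that ‖(b − c) ν^{−1}‖_{L^r(ν)} ≤ C. -/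
open MeasureTheory ENNReal Set Filter

noncomputable section

variable {d : ℕ}

theorem Cube.measurableSet_carrier_s17 (Q : Cube d) : MeasurableSet Q.carrier := by
  have h : Q.carrier = ⋂ i, {x : Rd d | Q.corner i ≤ x i ∧ x i < Q.corner i + Q.side} := by
    ext x
    simp [Cube.carrier]
  rw [h]
  refine MeasurableSet.iInter fun i => ?_
  have hx : Measurable fun x : Rd d => x i := by fun_prop
  exact (measurableSet_le measurable_const hx).inter (measurableSet_lt hx measurable_const)

/-- The centred cube `[-(n+1), n+1)^d`. -/
def centredCube (d n : ℕ) : Cube d :=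
  ⟨fun _ => -(n + 1), 2 * (n + 1), by positivity⟩

theorem eventually_mem_centredCube (x : Rd d) :
    ∀ᶠ n in atTop, x ∈ (centredCube d n).carrier := by
  filter_upwards [eventually_ge_atTop ⌈‖x‖⌉₊] with n hn i
  have h₁ : ‖x i‖ ≤ n := (PiLp.norm_apply_le x i).trans (Nat.ceil_le.mp hn)
  rw [Real.norm_eq_abs, abs_le] at h₁
  constructor <;> simp only [centredCube] <;> linarith

/-- Fatou's lemma along sets that eventually contain every point. -/
theorem lintegral_le_of_tendsto_of_setLIntegral_le {α : Type*} [MeasurableSpace α]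
    {μ : Measure α} {s : ℕ → Set α} {f : ℕ → α → ℝ≥0∞} {g : α → ℝ≥0∞} {K : ℝ≥0∞}
    (hs : ∀ n, MeasurableSet (s n)) (hmem : ∀ x, ∀ᶠ n in atTop, x ∈ s n)
    (hf : ∀ n, Measurable (f n)) (hlim : ∀ x, Tendsto (fun n => f n x) atTop (nhds (g x)))
    (hK : ∀ n, ∫⁻ x in s n, f n x ∂μ ≤ K) :
    ∫⁻ x, g x ∂μ ≤ K := by
  have hg : ∀ x, liminf (fun n => (s n).indicator (f n) x) atTop = g x := fun x => by
    refine Tendsto.liminf_eq ((hlim x).congr' ?_)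
    filter_upwards [hmem x] with n hn
    rw [indicator_of_mem hn]
  calc ∫⁻ x, g x ∂μ = ∫⁻ x, liminf (fun n => (s n).indicator (f n) x) atTop ∂μ := by
        simp only [hg]
    _ ≤ liminf (fun n => ∫⁻ x, (s n).indicator (f n) x ∂μ) atTop :=
        lintegral_liminf_le fun n => (hf n).indicator (hs n)
    _ ≤ liminf (fun _ => K) atTop := by
        refine liminf_le_liminf (Eventually.of_forall fun n => ?_)
        rw [lintegral_indicator (hs n)]
        exact hK n
    _ = K := liminf_const K

/-- **Lemma 5.2** (a weighted analogue of a lemma of Hytönen). Let `1 < r < ∞` and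
`ν ∈ A_{r'}`. If `‖(b − ⟨b⟩_Q) ν^{−1}‖_{L^r(ν 1_Q)} ≤ C` for all cubes `Q`, then there is
a constant `c` with `‖(b − c) ν^{−1}‖_{L^r(ν)} ≤ C`. -/
theorem stmt17 (d : ℕ) (hd : 0 < d) (r : ℝ) (hr : 1 < r)
    (ν : Rd d → ℝ) (hν : IsWeight ν) (hAp : IsApOn Set.univ (conj r) ν)
    (b : Rd d → ℝ) (hb : L1loc b)
    (C : ℝ)
    (hC : ∀ Q : Cube d,
      (∫⁻ x in Q.carrier,
          ENNReal.ofReal (|b x - avg Q b| * (ν x)⁻¹) ^ r * ENNReal.ofReal (ν x)) ^ (1 / r) ≤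
        ENNReal.ofReal C) :
    ∃ c : ℝ, wnorm r ν (fun x => (b x - c) * (ν x)⁻¹) ≤ ENNReal.ofReal C := by
  have hr₀ : 0 < r := one_pos.trans hr
  obtain ⟨hpos, hνm, -⟩ := hν
  have hbm := hb.1
  set F : ℝ → Rd d → ℝ≥0∞ := fun c x =>
    ENNReal.ofReal (|b x - c| * (ν x)⁻¹) ^ r * ENNReal.ofReal (ν x) with hF
  have hFm : ∀ c, Measurable (F c) := fun c => by fun_prop
  set a : ℕ → ℝ := fun n => avg (centredCube d n) b
  have hK : ∀ n, ∫⁻ x in (centredCube d n).carrier, F (a n) x ≤ ENNReal.ofReal C ^ r :=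
    fun n => by
      have h := ENNReal.rpow_le_rpow (hC (centredCube d n)) hr₀.le
      rwa [← ENNReal.rpow_mul, one_div_mul_cancel hr₀.ne', ENNReal.rpow_one] at h
  have key : ∀ (φ : ℕ → ℕ) (g : Rd d → ℝ≥0∞), StrictMono φ →
      (∀ x, Tendsto (fun n => F (a (φ n)) x) atTop (nhds (g x))) →
      ∫⁻ x, g x ≤ ENNReal.ofReal C ^ r := fun φ g hφ hlim =>
    lintegral_le_of_tendsto_of_setLIntegral_le
      (fun n => (centredCube d (φ n)).measurableSet_carrier_s17)
      (fun x => hφ.tendsto_atTop.eventually (eventually_mem_centredCube x))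
      (fun n => hFm _) hlim fun n => hK (φ n)
  have hfreq : ∃ M : ℝ, ∃ᶠ n in atTop, |a n| ≤ M := by
    by_contra! h
    have habs : Tendsto (fun n => |a n|) atTop atTop :=
      tendsto_atTop.mpr fun M =>
        (h M).mono fun n hn => hn.le
    have htop := key id (fun _ => ⊤) strictMono_id fun x => by
      have h₁ : Tendsto (fun n => |b x - a n| * (ν x)⁻¹) atTop atTop := by
        refine Tendsto.atTop_mul_const (inv_pos.mpr (hpos x)) ?_
        refine tendsto_atTop_mono (fun n => ?_) (tendsto_atTop_add_const_right _ (-|b x|) habs)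
        have h₂ := abs_sub_abs_le_abs_sub (a n) (b x)
        rw [abs_sub_comm] at h₂
        linarith
      have h₃ : Tendsto (fun n => ENNReal.ofReal (|b x - a n| * (ν x)⁻¹) ^ r) atTop
          (nhds (⊤ ^ r)) :=
        (ENNReal.continuous_rpow_const.tendsto _).comp
          (ENNReal.tendsto_ofReal_atTop.comp h₁)
      rw [ENNReal.top_rpow_of_pos hr₀] at h₃
      have hνx : ENNReal.ofReal (ν x) ≠ 0 := (ENNReal.ofReal_pos.mpr (hpos x)).ne'
      simpa [hF, ENNReal.top_mul hνx] using
        ENNReal.Tendsto.mul_const (b := ENNReal.ofReal (ν x)) h₃ (Or.inl ENNReal.top_ne_zero)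
    rw [lintegral_const, ENNReal.top_mul (NeZero.ne _), top_le_iff] at htop
    exact ENNReal.rpow_ne_top_of_nonneg hr₀.le ENNReal.ofReal_ne_top htop
  obtain ⟨M, hM⟩ := hfreq
  obtain ⟨c, -, φ, hφ, hc⟩ := tendsto_subseq_of_frequently_bounded
    (Metric.isBounded_Icc (-M) M) (hM.mono fun n hn => abs_le.mp hn)
  refine ⟨c, ?_⟩
  have hle := key φ (F c) hφ fun x => by
    refine ENNReal.Tendsto.mul_const ?_ (Or.inr ENNReal.ofReal_ne_top)
    refine (ENNReal.continuous_rpow_const.tendsto _).comp (ENNReal.tendsto_ofReal ?_)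
    exact ((tendsto_const_nhds.sub hc).abs).mul_const _
  have hint : ∀ x, ENNReal.ofReal (|(b x - c) * (ν x)⁻¹| ^ r * ν x) = F c x := fun x => by
    have hν₀ := inv_pos.mpr (hpos x)
    rw [ENNReal.ofReal_mul (by positivity), ← ENNReal.ofReal_rpow_of_nonneg (abs_nonneg _) hr₀.le,
      abs_mul, abs_of_pos hν₀]
  simp only [wnorm, hint]
  calc (∫⁻ x, F c x) ^ (1 / r) ≤ (ENNReal.ofReal C ^ r) ^ (1 / r) :=
        ENNReal.rpow_le_rpow hle (by positivity)
    _ = ENNReal.ofReal C := by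
        rw [← ENNReal.rpow_mul, mul_one_div_cancel hr₀.ne', ENNReal.rpow_one]
end
end
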